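/- Let U_4 = {x ∈ ℝ^4 : Ax ≥ b} be the Klee–Walkup polyhedron, where A has rows (−6,−3,0,1), (−3,−6,1,0), (−35,−45,6,3), (−45,−35,3,6), (1,0,0,0), (0,1,0,0), (0,0,1,0), (0,0,0,1) and b = (−1,−1,−8,−8,0,0,0,0)^T. Then the circuit diameter of U_4 is at most 4; in particular, the circuit distance between the vertex incident to the last four facets (the origin) and the vertex incident to the first four facets is at most 4 in both directions. -/

import Mathlib

open scoped BigOperators

/-- Data defining a polyhedron `{z ∈ ℝ^d : A z ≥ b}` with rational data.
Under the `IsProper` assumption below it is full-dimensional with an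
irredundant description, hence `d`-dimensional with exactly `f` facets. -/
structure PolyData (d f : ℕ) where
  A : Matrix (Fin f) (Fin d) ℚ
  b : Fin f → ℚ

namespace PolyData

variable {d f : ℕ}

/-- The `i`-th row of `A` (outer normal of the `i`-th facet), as a real vector. -/
def row (P : PolyData d f) (i : Fin f) : Fin d → ℝ := fun j => (P.A i j : ℝ)

/-- The `i`-th right-hand side, as a real number. -/
def rhs (P : PolyData d f) (i : Fin f) : ℝ := (P.b i : ℝ)

/-- Value of the `i`-th linear form at `z`. -/
def eval (P : PolyData d f) (i : Fin f) (z : Fin d → ℝ) : ℝ := ∑ j, P.row i j * z j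

/-- The feasible set `{z : A z ≥ b}`. -/
def toSet (P : PolyData d f) : Set (Fin d → ℝ) := {z | ∀ i, P.rhs i ≤ P.eval i z}

/-- Indices of the constraints (facets) active (incident) at `z`. -/
def activeAt (P : PolyData d f) (z : Fin d → ℝ) : Set (Fin f) := {i | P.eval i z = P.rhs i}

/-- The `i`-th facet, as a subset of the polyhedron. -/
def facet (P : PolyData d f) (i : Fin f) : Set (Fin d → ℝ) :=
  {z ∈ P.toSet | P.eval i z = P.rhs i}

/-- The standing assumption: the polyhedron is full-dimensional and the
description is irredundant, i.e. every inequality is facet-defining. -/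
def IsProper (P : PolyData d f) : Prop :=
  (∃ z, ∀ i, P.rhs i < P.eval i z) ∧
  ∀ i, ∃ z ∈ P.toSet, P.eval i z = P.rhs i ∧ ∀ i', i' ≠ i → P.rhs i' < P.eval i' z

/-- A vertex: a feasible point whose active outer normals span `ℝ^d`. -/
def IsVertex (P : PolyData d f) (v : Fin d → ℝ) : Prop :=
  v ∈ P.toSet ∧ Submodule.span ℝ (P.row '' P.activeAt v) = ⊤

/-- A circuit direction of `P`: a nonzero `g` such that `A g` is
support-minimal in `{A x : x ≠ 0}` (taken here up to scaling). -/
def IsCircuit (P : PolyData d f) (g : Fin d → ℝ) : Prop :=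
  g ≠ 0 ∧ ∀ x : Fin d → ℝ, x ≠ 0 →
    {i | P.eval i x ≠ 0} ⊆ {i | P.eval i g ≠ 0} →
    {i | P.eval i x ≠ 0} = {i | P.eval i g ≠ 0}

/-- The set of circuits of `P`. -/
def circuits (P : PolyData d f) : Set (Fin d → ℝ) := {g | P.IsCircuit g}

/-- A (maximal) circuit walk `y 0, …, y k` of length `k`. -/
def IsCircuitWalk (P : PolyData d f) {k : ℕ} (y : Fin (k+1) → Fin d → ℝ) : Prop :=
  (∀ i, y i ∈ P.toSet) ∧
  ∀ i : Fin k, ∃ g ∈ P.circuits, ∃ α : ℝ, 0 < α ∧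
    y i.succ = y i.castSucc + α • g ∧
    ∀ β : ℝ, α < β → y i.castSucc + β • g ∉ P.toSet

/-- The circuit distance from `u` to `v`: minimum length of a circuit walk. -/
noncomputable def circuitDistance (P : PolyData d f) (u v : Fin d → ℝ) : ℕ∞ :=
  sInf {n : ℕ∞ | ∃ k : ℕ, n = (k : ℕ∞) ∧ ∃ y : Fin (k+1) → Fin d → ℝ,
    P.IsCircuitWalk y ∧ y 0 = u ∧ y (Fin.last k) = v}

/-- The circuit diameter: maximum circuit distance between two vertices. -/
noncomputable def circuitDiameter (P : PolyData d f) : ℕ∞ :=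
  ⨆ (u : Fin d → ℝ) (v : Fin d → ℝ) (_ : P.IsVertex u) (_ : P.IsVertex v),
    P.circuitDistance u v

/-- `u` and `v` are joined by an edge of `P`. -/
def IsEdge (P : PolyData d f) (u v : Fin d → ℝ) : Prop :=
  P.IsVertex u ∧ P.IsVertex v ∧ u ≠ v ∧
  segment ℝ u v = {z ∈ P.toSet | P.activeAt u ∩ P.activeAt v ⊆ P.activeAt z}

/-- An edge walk along vertices of `P`. -/
def IsEdgeWalk (P : PolyData d f) {k : ℕ} (y : Fin (k+1) → Fin d → ℝ) : Prop :=
  ∀ i : Fin k, P.IsEdge (y i.castSucc) (y i.succ)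

/-- Combinatorial (edge) distance between two vertices. -/
noncomputable def edgeDistance (P : PolyData d f) (u v : Fin d → ℝ) : ℕ∞ :=
  sInf {n : ℕ∞ | ∃ k : ℕ, n = (k : ℕ∞) ∧ ∃ y : Fin (k+1) → Fin d → ℝ,
    P.IsEdgeWalk y ∧ y 0 = u ∧ y (Fin.last k) = v}

/-- Combinatorial (edge) diameter. -/
noncomputable def edgeDiameter (P : PolyData d f) : ℕ∞ :=
  ⨆ (u : Fin d → ℝ) (v : Fin d → ℝ) (_ : P.IsVertex u) (_ : P.IsVertex v),
    P.edgeDistance u v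

end PolyData

/-- `Δ_E(f,d)`: maximum combinatorial diameter of a `d`-dimensional
polyhedron with `f` facets. -/
noncomputable def maxEdgeDiameter (f d : ℕ) : ℕ∞ :=
  ⨆ (P : PolyData d f) (_ : P.IsProper), P.edgeDiameter

/-- `Δ_C(f,d)`: maximum circuit diameter of a `d`-dimensional polyhedron
with `f` facets. -/
noncomputable def maxCircuitDiameter (f d : ℕ) : ℕ∞ :=
  ⨆ (P : PolyData d f) (_ : P.IsProper), P.circuitDiameter

/-- `Δ_C^u(f,d)`: maximum circuit diameter of an unbounded `d`-dimensional
polyhedron with `f` facets. -/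
noncomputable def maxUnboundedCircuitDiameter (f d : ℕ) : ℕ∞ :=
  ⨆ (P : PolyData d f) (_ : P.IsProper ∧ ¬ Bornology.IsBounded P.toSet),
    P.circuitDiameter

namespace PolyData

variable {d f : ℕ}

/-- A walk is simple if each step enters exactly one new facet. -/
def IsSimpleWalk (P : PolyData d f) {k : ℕ} (y : Fin (k+1) → Fin d → ℝ) : Prop :=
  ∀ i : Fin k, (P.activeAt (y i.succ) \ P.activeAt (y i.castSucc)).ncard = 1

/-- `P` is `C`-simple: all circuit walks of length at most `Δ_E(f,d)` are simple. -/
def IsCSimple (P : PolyData d f) : Prop :=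
  ∀ k : ℕ, (k : ℕ∞) ≤ maxEdgeDiameter f d →
    ∀ y : Fin (k+1) → Fin d → ℝ, P.IsCircuitWalk y → P.IsSimpleWalk y

/-- A non-revisiting walk: each step enters a facet containing no earlier
point of the walk. -/
def IsNonRevisiting (P : PolyData d f) {k : ℕ} (y : Fin (k+1) → Fin d → ℝ) : Prop :=
  ∀ i : Fin k, ∃ j : Fin f, j ∈ P.activeAt (y i.succ) ∧
    ∀ i' : Fin (k+1), i' ≤ i.castSucc → j ∉ P.activeAt (y i')

/-- `P` is a simple polyhedron: every vertex lies on exactly `d` facets. -/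
def IsSimplePoly (P : PolyData d f) : Prop :=
  ∀ v, P.IsVertex v → (P.activeAt v).ncard = d

end PolyData

/-- Append a last coordinate: `(z, t) ∈ ℝ^{d+1}`. -/
def snocVec {d : ℕ} (z : Fin d → ℝ) (t : ℝ) : Fin (d+1) → ℝ := Fin.snoc z t

namespace PolyData

variable {d f : ℕ}

/-- `W` is a wedge on `P` over the facet with index `i₀`:
`W = H^≤ ∩ (P × [0,∞))`, where the boundary hyperplane `H = {w : a·w = β}`
of the halfspace `H^≤` contains `P × {0}` on its feasible side, meets the
interior of `P × [0,∞)`, and meets `P × {0}` exactly in the facet `i₀`. -/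
def IsWedgeOver (W : PolyData (d+1) (f+1)) (P : PolyData d f) (i₀ : Fin f) : Prop :=
  ∃ (a : Fin (d+1) → ℝ) (β : ℝ),
    (∀ z ∈ P.toSet, ∑ j, a j * snocVec z 0 j ≤ β) ∧
    (∃ z, (∀ i, P.rhs i < P.eval i z) ∧ ∃ t : ℝ, 0 < t ∧ ∑ j, a j * snocVec z t j = β) ∧
    (∀ z ∈ P.toSet, (∑ j, a j * snocVec z 0 j = β ↔ z ∈ P.facet i₀)) ∧
    W.toSet = {w | ∑ j, a j * w j ≤ β} ∩
      {w | ∃ z ∈ P.toSet, ∃ t : ℝ, 0 ≤ t ∧ w = snocVec z t}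

/-- `P` is wedge-simple: it is `C`-simple and over every facet there is a
`C`-simple wedge. -/
def IsWedgeSimple (P : PolyData d f) : Prop :=
  P.IsCSimple ∧ ∀ i₀ : Fin f, ∃ W : PolyData (d+1) (f+1),
    W.IsProper ∧ W.IsWedgeOver P i₀ ∧ W.IsCSimple

end PolyData

/-- `k`-wedge-simplicity: `0`-wedge-simple means `C`-simple, and `P` is
`(k+1)`-wedge-simple if it is `C`-simple and over every facet there is a
`k`-wedge-simple wedge.  In particular `1`-wedge-simple = wedge-simple. -/
def IsKWedgeSimpleAux : ℕ → (d f : ℕ) → PolyData d f → Prop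
  | 0, _, _, P => P.IsCSimple
  | (k+1), d, f, P => P.IsCSimple ∧ ∀ i₀ : Fin f,
      ∃ W : PolyData (d+1) (f+1), W.IsProper ∧ W.IsWedgeOver P i₀ ∧
        IsKWedgeSimpleAux k (d+1) (f+1) W

def IsKWedgeSimple (k : ℕ) {d f : ℕ} (P : PolyData d f) : Prop :=
  IsKWedgeSimpleAux k d f P

namespace PolyData

variable {d : ℕ}

/-- `(P, u, v)` is a Dantzig figure: a `d`-dimensional polyhedron with `2d`
facets, `d` of which are incident to the vertex `u` and the other `d` to the
vertex `v`. -/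
def IsDantzigFigure (P : PolyData d (2*d)) (u v : Fin d → ℝ) : Prop :=
  P.IsVertex u ∧ P.IsVertex v ∧ Disjoint (P.activeAt u) (P.activeAt v) ∧
  P.activeAt u ∪ P.activeAt v = Set.univ ∧
  (P.activeAt u).ncard = d ∧ (P.activeAt v).ncard = d

end PolyData

/-- The (exposed) faces of a polyhedron, each obtained by turning a subset of
the inequalities into equations. -/
def PolyData.faces {d f : ℕ} (P : PolyData d f) : Set (Set (Fin d → ℝ)) :=
  {F | ∃ S : Set (Fin f), F = {z ∈ P.toSet | S ⊆ P.activeAt z}}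

/-- Combinatorial equivalence: an inclusion-preserving bijection between the
face lattices. -/
def CombEquiv {d f d' f' : ℕ} (P : PolyData d f) (Q : PolyData d' f') : Prop :=
  ∃ φ : Set (Fin d → ℝ) → Set (Fin d' → ℝ),
    Set.BijOn φ P.faces Q.faces ∧
    ∀ F ∈ P.faces, ∀ G ∈ P.faces, (F ⊆ G ↔ φ F ⊆ φ G)

/-- Two facets are adjacent if they share a ridge (a codimension-2 face). -/
def PolyData.AdjacentFacets {d f : ℕ} (P : PolyData d f) (i j : Fin f) : Prop :=
  i ≠ j ∧ Module.finrank ℝ (affineSpan ℝ (P.facet i ∩ P.facet j)).direction = d - 2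

/-- The Klee–Walkup polyhedron `U_4`. -/
def U4 : PolyData 4 8 where
  A := !![-6,-3,0,1; -3,-6,1,0; -35,-45,6,3; -45,-35,3,6;
          1,0,0,0; 0,1,0,0; 0,0,1,0; 0,0,0,1]
  b := ![-1,-1,-8,-8,0,0,0,0]

namespace PolyData

variable {d f : ℕ}

/-- Value of the `i`-th linear form at a rational point. -/
def evalRat (P : PolyData d f) (i : Fin f) (z : Fin d → ℚ) : ℚ := ∑ j, P.A i j * z j

/-- A rational point viewed as a real point. -/
def castVec (z : Fin d → ℚ) : Fin d → ℝ := fun j => (z j : ℝ)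

theorem eval_castVec (P : PolyData d f) (i : Fin f) (z : Fin d → ℚ) :
    P.eval i (castVec z) = (P.evalRat i z : ℝ) := by
  simp [eval, evalRat, castVec, row]

theorem eval_sub (P : PolyData d f) (i : Fin f) (x y : Fin d → ℝ) :
    P.eval i (x - y) = P.eval i x - P.eval i y := by
  simp [eval, mul_sub, Finset.sum_sub_distrib]

theorem eval_add (P : PolyData d f) (i : Fin f) (x y : Fin d → ℝ) :
    P.eval i (x + y) = P.eval i x + P.eval i y := by
  simp [eval, mul_add, Finset.sum_add_distrib]

theorem eval_smul (P : PolyData d f) (i : Fin f) (c : ℝ) (x : Fin d → ℝ) :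
    P.eval i (c • x) = c * P.eval i x := by
  simp [eval, Finset.mul_sum, mul_left_comm]

theorem castVec_mem_toSet {P : PolyData d f} {z : Fin d → ℚ} :
    castVec z ∈ P.toSet ↔ ∀ i, P.b i ≤ P.evalRat i z := by
  simp [toSet, eval_castVec, rhs]

theorem circuitDistance_self {P : PolyData d f} {u : Fin d → ℝ} (hu : u ∈ P.toSet) (n : ℕ) :
    P.circuitDistance u u ≤ n :=
  (show P.circuitDistance u u ≤ ((0 : ℕ) : ℕ∞) from
    sInf_le ⟨0, rfl, fun _ => u, ⟨fun _ => hu, fun i => i.elim0⟩, rfl, rfl⟩).trans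
    (by exact_mod_cast n.zero_le)

/-- One maximal circuit step from `u` to `v`. -/
def IsCircuitStep (P : PolyData d f) (u v : Fin d → ℝ) : Prop :=
  ∃ g ∈ P.circuits, ∃ α : ℝ, 0 < α ∧ v = u + α • g ∧ ∀ β : ℝ, α < β → u + β • g ∉ P.toSet

theorem circuitDistance_le_succ {P : PolyData d f} {u v w : Fin d → ℝ} {n : ℕ}
    (hu : u ∈ P.toSet) (huv : P.IsCircuitStep u v) (hvw : P.circuitDistance v w ≤ n) :
    P.circuitDistance u w ≤ (n + 1 : ℕ) := by
  have hlt : P.circuitDistance v w < ⊤ := hvw.trans_lt (ENat.natCast_lt_top n)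
  have hne : {m : ℕ∞ | ∃ k : ℕ, m = (k : ℕ∞) ∧ ∃ y : Fin (k + 1) → Fin d → ℝ,
      P.IsCircuitWalk y ∧ y 0 = v ∧ y (Fin.last k) = w}.Nonempty := by
    refine Set.nonempty_iff_ne_empty.2 fun h => ?_
    rw [circuitDistance, h, sInf_empty] at hlt
    exact lt_irrefl _ hlt
  obtain ⟨k, hk, y, ⟨hy, hstep⟩, h0, hlast⟩ := csInf_mem hne
  have hkn : k ≤ n := by
    have h := hvw
    rw [circuitDistance, hk] at h
    exact_mod_cast h
  suffices h : P.circuitDistance u w ≤ ((k + 1 : ℕ) : ℕ∞) from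
    h.trans (by exact_mod_cast Nat.succ_le_succ hkn)
  refine sInf_le ⟨k + 1, rfl, Fin.cons u y, ⟨?_, ?_⟩, rfl, ?_⟩
  · exact Fin.cases hu hy
  · refine Fin.cases ?_ fun i => ?_
    · simpa [h0, IsCircuitStep] using huv
    · simpa [← Fin.succ_castSucc] using hstep i
  · rw [← Fin.succ_last, Fin.cons_succ, hlast]

theorem isCircuit_of_ker_le_span {P : PolyData d f} {g : Fin d → ℝ} (hg : g ≠ 0)
    (h : ∀ x, (∀ i, P.eval i g = 0 → P.eval i x = 0) → ∃ c : ℝ, x = c • g) :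
    P.IsCircuit g := by
  refine ⟨hg, fun x hx hsub => ?_⟩
  obtain ⟨c, rfl⟩ := h x fun i hi => by
    by_contra hne
    exact hsub hne hi
  have hc : c ≠ 0 := by
    rintro rfl
    simp at hx
  ext i
  simp [eval_smul, hc]

/-- If `d` rows consisting of `g` and normals orthogonal to `g` are independent,
then `g` is a circuit. -/
theorem isCircuit_castVec {n : ℕ} {P : PolyData (n + 1) f} {g : Fin (n + 1) → ℚ}
    (s : Fin n → Fin f) (hs : ∀ k, P.evalRat (s k) g = 0)
    (hdet : (Matrix.of (Fin.cons g fun k => P.A (s k) :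
      Fin (n + 1) → Fin (n + 1) → ℚ)).det ≠ 0) :
    P.IsCircuit (castVec g) := by
  set M : Matrix (Fin (n + 1)) (Fin (n + 1)) ℚ :=
    Matrix.of (Fin.cons g fun k => P.A (s k)) with hM
  have hg : g ≠ 0 := by
    rintro rfl
    exact hdet (Matrix.det_eq_zero_of_row_eq_zero 0 fun j => by simp [hM])
  have hgg : ∑ j, (g j : ℝ) * g j ≠ 0 := by
    have h : g ⬝ᵥ g ≠ 0 := fun h => hg (dotProduct_self_eq_zero.1 h)
    simp only [dotProduct] at h
    exact_mod_cast h
  refine isCircuit_of_ker_le_span (fun h => hg ?_) fun x hx => ?_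
  · ext j
    have := congrFun h j
    simpa [castVec] using this
  · set c : ℝ := (∑ j, (g j : ℝ) * x j) / ∑ j, (g j : ℝ) * g j with hc
    refine ⟨c, sub_eq_zero.1 ?_⟩
    have hdet' : (M.map (Rat.castHom ℝ)).det ≠ 0 := by
      rw [← RingHom.mapMatrix_apply, ← RingHom.map_det]
      simpa using hdet
    refine Matrix.eq_zero_of_mulVec_eq_zero hdet' (funext fun k => ?_)
    refine Fin.cases ?_ (fun k => ?_) k
    · have : ∑ j, (g j : ℝ) * (x j - c * g j) = 0 := by
        simp only [mul_sub, Finset.sum_sub_distrib, mul_left_comm _ c, ← Finset.mul_sum]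
        rw [hc, div_mul_cancel₀ _ hgg, sub_self]
      simpa [Matrix.mulVec, dotProduct, hM, castVec] using this
    · have h0 : P.eval (s k) (castVec g) = 0 := by simp [eval_castVec, hs k]
      have : P.eval (s k) (x - c • castVec g) = 0 := by
        rw [eval_sub, eval_smul, h0, hx _ h0]
        simp
      simpa [Matrix.mulVec, dotProduct, hM, castVec, eval, row] using this

theorem isCircuitStep_castVec {n : ℕ} {P : PolyData (n + 1) f} {u v : Fin (n + 1) → ℚ}
    (s : Fin n → Fin f) (hs : ∀ k, P.evalRat (s k) (v - u) = 0)
    (hdet : (Matrix.of (Fin.cons (v - u) fun k => P.A (s k) :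
      Fin (n + 1) → Fin (n + 1) → ℚ)).det ≠ 0)
    {i : Fin f} (hv : P.evalRat i v = P.b i) (hu : P.b i < P.evalRat i u) :
    P.IsCircuitStep (castVec u) (castVec v) := by
  refine ⟨castVec (v - u), isCircuit_castVec s hs hdet, 1, one_pos, ?_, fun β hβ hmem => ?_⟩
  · ext j
    simp [castVec]
  · have h := hmem i
    have hsub : castVec (v - u) = castVec v - castVec u := by
      ext j
      simp [castVec]
    have hu' : (P.b i : ℝ) < P.evalRat i u := by exact_mod_cast hu
    rw [eval_add, eval_smul, hsub, eval_sub, eval_castVec, eval_castVec, hv, rhs] at h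
    nlinarith

/-- A vector annihilated by a spanning set of normals vanishes. -/
theorem eq_zero_of_span_row_eq_top {P : PolyData d f} {S : Set (Fin f)}
    (hS : Submodule.span ℝ (P.row '' S) = ⊤) {x : Fin d → ℝ}
    (hx : ∀ i ∈ S, P.eval i x = 0) : x = 0 := by
  have h : x ∈ Submodule.span ℝ (P.row '' S) := hS ▸ Submodule.mem_top
  have key : ∀ y ∈ Submodule.span ℝ (P.row '' S), y ⬝ᵥ x = 0 := by
    intro y hy
    induction hy using Submodule.span_induction with
    | mem y hy =>
      obtain ⟨i, hi, rfl⟩ := hy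
      exact hx i hi
    | zero => simp
    | add y z _ _ hy hz => rw [add_dotProduct, hy, hz, add_zero]
    | smul c y _ hy => rw [smul_dotProduct, hy, smul_zero]
  exact dotProduct_self_eq_zero.1 (key x h)

/-- A vertex is determined by `d` independent active constraints. -/
theorem IsVertex.exists_independent_active {P : PolyData d f} {v : Fin d → ℝ}
    (hv : P.IsVertex v) :
    ∃ e : Fin d ↪o Fin f, (∀ k, P.eval (e k) v = P.rhs (e k)) ∧
      (Matrix.of fun k => P.A (e k)).det ≠ 0 ∧
      ∀ x, (∀ k, P.eval (e k) x = 0) → x = 0 := by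
  classical
  obtain ⟨κ, a, ha, hspan, hli⟩ :=
    exists_linearIndependent' ℝ (fun i : P.activeAt v => P.row i)
  have htop : Submodule.span ℝ (Set.range ((fun i : P.activeAt v => P.row i) ∘ a)) = ⊤ := by
    rw [hspan, ← hv.2, Set.image_eq_range]
  have : Finite κ := Finite.of_injective a ha
  have := Fintype.ofFinite κ
  have hcard : Fintype.card κ = d := by
    rw [← finrank_span_eq_card hli, htop, finrank_top, Module.finrank_fin_fun]
  set s : Finset (Fin f) := Finset.univ.image fun k => (a k : Fin f) with hs
  have hscard : s.card = d := by
    have hinj : Function.Injective fun k => (a k : Fin f) := Subtype.val_injective.comp ha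
    rw [hs, Finset.card_image_of_injective _ hinj, Finset.card_univ, hcard]
  have hker : ∀ x, (∀ k, P.eval (s.orderEmbOfFin hscard k) x = 0) → x = 0 := by
    intro x hx
    refine eq_zero_of_span_row_eq_top (P := P) (S := Set.range fun k => (a k : Fin f)) ?_ ?_
    · rw [← htop, ← Set.range_comp]
      rfl
    · rintro _ ⟨k, rfl⟩
      have hmem : (a k : Fin f) ∈ Set.range (s.orderEmbOfFin hscard) := by
        rw [Finset.range_orderEmbOfFin]
        simp [hs]
      obtain ⟨l, hl⟩ := hmem
      simpa [← hl] using hx l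
  refine ⟨s.orderEmbOfFin hscard, fun k => ?_, fun h => ?_, hker⟩
  · obtain ⟨l, -, hl⟩ := Finset.mem_image.1 (s.orderEmbOfFin_mem hscard k)
    rw [← hl]
    exact (a l).2
  · obtain ⟨x, hx, hx0⟩ := Matrix.exists_mulVec_eq_zero_iff.2 h
    refine hx (funext fun j => ?_)
    have h0 := hker (castVec x) fun k => by
      rw [eval_castVec]
      exact_mod_cast congrFun hx0 k
    simpa [castVec] using congrFun h0 j

end PolyData

/-- The determinant of a `4 × 4` matrix, expanded along its first two rows. -/
def detFour (M : Fin 4 → Fin 4 → ℚ) : ℚ :=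
  (M 0 0 * M 1 1 - M 0 1 * M 1 0) * (M 2 2 * M 3 3 - M 2 3 * M 3 2) -
  (M 0 0 * M 1 2 - M 0 2 * M 1 0) * (M 2 1 * M 3 3 - M 2 3 * M 3 1) +
  (M 0 0 * M 1 3 - M 0 3 * M 1 0) * (M 2 1 * M 3 2 - M 2 2 * M 3 1) +
  (M 0 1 * M 1 2 - M 0 2 * M 1 1) * (M 2 0 * M 3 3 - M 2 3 * M 3 0) -
  (M 0 1 * M 1 3 - M 0 3 * M 1 1) * (M 2 0 * M 3 2 - M 2 2 * M 3 0) +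
  (M 0 2 * M 1 3 - M 0 3 * M 1 2) * (M 2 0 * M 3 1 - M 2 1 * M 3 0)

theorem det_of_eq_detFour (M : Fin 4 → Fin 4 → ℚ) : (Matrix.of M).det = detFour M := by
  simp [Matrix.det_succ_row_zero, Fin.sum_univ_succ, Fin.succAbove, detFour]
  ring

namespace U4

/-- The vertices of `U4` (indices below `15`), followed by six further points of `U4`
used by circuit walks. -/
def point : Fin 21 → Fin 4 → ℚ :=
  ![![1, 1, 8, 8], ![0, 1/2, 13/6, 1/2], ![0, 1/3, 11/9, 0], ![2/9, 0, 0, 1/3],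
    ![11/75, 1/25, 0, 0], ![1/6, 0, 0, 0], ![1/2, 0, 1/2, 13/6], ![0, 2/9, 1/3, 0],
    ![1/3, 0, 0, 11/9], ![1/25, 11/75, 0, 0], ![0, 1/6, 0, 0], ![0, 8/25, 16/15, 0],
    ![8/25, 0, 0, 16/15], ![1/10, 1/10, 0, 0], ![0, 0, 0, 0], ![0, 3, 17, 9],
    ![3, 3, 26, 26], ![1, 3, 20, 14], ![1, 0, 8, 5], ![0, 0, 5, 5], ![0, 0, 0, 5]]

/-- Some of the maximal circuit steps between the points in `point`. -/
def next : Fin 21 → List (Fin 21) :=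
  ![[1, 6, 18], [0, 11], [4, 11], [5, 12], [5, 13], [3, 4, 14], [0, 12], [10, 11], [12],
    [8, 10], [7, 9, 14], [1, 2, 7], [3, 6, 8, 13], [9, 11], [5, 10, 15], [16], [17], [0],
    [19], [20], [14]]

/-- The points reached from `u` by at most `n` steps of `next`. -/
def reach : ℕ → Fin 21 → List (Fin 21)
  | 0, u => [u]
  | n + 1, u => u :: (next u).flatMap (reach n)

theorem mem_reach_four : ∀ u v : Fin 21, u < 15 → v < 15 → v ∈ reach 4 u := by
  decide +kernel

theorem point_feasible : ∀ u i, U4.b i ≤ U4.evalRat i (point u) := by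
  decide +kernel

theorem next_certificate : ∀ u, ∀ v ∈ next u,
    (∃ i, U4.evalRat i (point v) = U4.b i ∧ U4.b i < U4.evalRat i (point u)) ∧
    ∃ i, U4.evalRat i (point v - point u) = 0 ∧
    ∃ j, i < j ∧ U4.evalRat j (point v - point u) = 0 ∧
    ∃ k, j < k ∧ U4.evalRat k (point v - point u) = 0 ∧
      detFour (Fin.cons (point v - point u) fun t => U4.A (![i, j, k] t)) ≠ 0 := by
  decide +kernel

/-- Cramer's rule for the point where the four constraints indexed by `s` are tight. -/
def basicSolution (s : Fin 4 → Fin 8) : Fin 4 → ℚ := fun c =>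
  detFour (fun k j => if j = c then U4.b (s k) else U4.A (s k) j) /
    detFour (fun k => U4.A (s k))

theorem basicSolution_certificate : ∀ i j : Fin 8, i < j → ∀ k, j < k → ∀ l, k < l →
    detFour (fun t => U4.A (![i, j, k, l] t)) ≠ 0 →
    (∀ t, U4.evalRat (![i, j, k, l] t) (basicSolution ![i, j, k, l]) =
      U4.b (![i, j, k, l] t)) ∧
    ((∃ t, U4.evalRat t (basicSolution ![i, j, k, l]) < U4.b t) ∨
      ∃ m : Fin 21, m < 15 ∧ basicSolution ![i, j, k, l] = point m) := by
  decide +kernel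

theorem isCircuitStep_next {u v : Fin 21} (h : v ∈ next u) :
    U4.IsCircuitStep (PolyData.castVec (point u)) (PolyData.castVec (point v)) := by
  obtain ⟨⟨t, hv, hu⟩, i, hi, j, -, hj, k, -, hk, hdet⟩ := next_certificate u v h
  refine PolyData.isCircuitStep_castVec ![i, j, k] ?_ ?_ hv hu
  · intro l
    fin_cases l
    exacts [hi, hj, hk]
  · rwa [det_of_eq_detFour]

theorem circuitDistance_le_of_mem_reach {n : ℕ} {u v : Fin 21} (h : v ∈ reach n u) :
    U4.circuitDistance (PolyData.castVec (point u)) (PolyData.castVec (point v)) ≤ n := by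
  induction n generalizing u with
  | zero =>
    obtain rfl : v = u := by simpa [reach] using h
    exact PolyData.circuitDistance_self (PolyData.castVec_mem_toSet.2 (point_feasible v)) 0
  | succ n ih =>
    have hu := PolyData.castVec_mem_toSet.2 (point_feasible u)
    simp only [reach, List.mem_cons, List.mem_flatMap] at h
    obtain rfl | ⟨w, hw, hv⟩ := h
    · exact PolyData.circuitDistance_self hu _
    · exact PolyData.circuitDistance_le_succ hu (isCircuitStep_next hw) (ih hv)

theorem exists_point_of_isVertex {v : Fin 4 → ℝ} (hv : U4.IsVertex v) :
    ∃ m : Fin 21, m < 15 ∧ v = PolyData.castVec (point m) := by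
  obtain ⟨e, hact, hdet, hker⟩ := hv.exists_independent_active
  have he : ![e 0, e 1, e 2, e 3] = e := by
    ext k
    fin_cases k <;> rfl
  have hcert := basicSolution_certificate (e 0) (e 1) (e.strictMono (by decide)) (e 2)
    (e.strictMono (by decide)) (e 3) (e.strictMono (by decide))
  rw [he] at hcert
  rw [det_of_eq_detFour] at hdet
  obtain ⟨hsol, hcase⟩ := hcert hdet
  have hveq : v = PolyData.castVec (basicSolution e) := sub_eq_zero.1 <| hker _ fun k => by
    rw [PolyData.eval_sub, hact, PolyData.eval_castVec, hsol, PolyData.rhs, sub_self]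
  obtain ⟨t, ht⟩ | ⟨m, hm, hpt⟩ := hcase
  · have hmem := hv.1
    rw [hveq] at hmem
    exact absurd (PolyData.castVec_mem_toSet.1 hmem t) (not_le.2 ht)
  · exact ⟨m, hm, hpt ▸ hveq⟩

theorem circuitDistance_le_four {u v : Fin 4 → ℝ} (hu : U4.IsVertex u) (hv : U4.IsVertex v) :
    U4.circuitDistance u v ≤ 4 := by
  obtain ⟨k, hk, rfl⟩ := exists_point_of_isVertex hu
  obtain ⟨l, hl, rfl⟩ := exists_point_of_isVertex hv
  exact circuitDistance_le_of_mem_reach (mem_reach_four k l hk hl)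

theorem isVertex_zero : U4.IsVertex 0 := by
  refine ⟨fun i => ?_, eq_top_iff.2 fun x _ => ?_⟩
  · fin_cases i <;> simp [PolyData.rhs, PolyData.eval, U4]
  · rw [pi_eq_sum_univ x]
    refine Submodule.sum_mem _ fun j _ => Submodule.smul_mem _ _ (Submodule.subset_span ?_)
    refine ⟨Fin.natAdd 4 j, ?_, ?_⟩
    · fin_cases j <;> simp [PolyData.activeAt, PolyData.rhs, PolyData.eval, U4]
    · ext l
      fin_cases j <;> fin_cases l <;> simp [PolyData.row, U4]

end U4

/-- the circuit diameter of the Klee–Walkup polyhedron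
`U_4` is at most `4`; in particular the circuit distance between the vertex
on the last four facets (the origin) and the vertex on the first four facets
is at most `4` in both directions. -/
theorem U4_circuitDiameter_le_four :
    U4.circuitDiameter ≤ 4 ∧
    ∀ w : Fin 4 → ℝ, U4.IsVertex w →
      (∀ i : Fin 8, (i : ℕ) < 4 → i ∈ U4.activeAt w) →
      U4.circuitDistance 0 w ≤ 4 ∧ U4.circuitDistance w 0 ≤ 4 := by
  exact ⟨iSup_le fun u => iSup_le fun v => iSup_le fun hu => iSup_le fun hv =>
      U4.circuitDistance_le_four hu hv,
    fun w hw _ => ⟨U4.circuitDistance_le_four U4.isVertex_zero hw,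
      U4.circuitDistance_le_four hw U4.isVertex_zero⟩⟩
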